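/- There exists no welfarist committee rule that satisfies laminar proportionality, i.e., no welfarist rule returns only laminar proportional committees on every laminar instance. -/

import Mathlib

/-!
Common framework for approval-based committee elections
(Peters & Skowron, "Proportionality and the Limits of Welfarism").
-/

namespace ABC

/-- An election instance: a finite set `C` of candidates, a finite set `N` of voters,
an approval ballot `A i ⊆ C` for each voter `i`, and a committee size `k`. -/
structure Election where
  C : Finset ℕ
  N : Finset ℕ
  A : ℕ → Finset ℕ
  k : ℕ

/-- Basic well-formedness of an election instance: ballots are sets of candidates,
`k ≤ |C|`, and the instance is nondegenerate (`k ≥ 1`, `n ≥ 1`). -/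
def Election.Valid (E : Election) : Prop :=
  (∀ i ∈ E.N, E.A i ⊆ E.C) ∧ E.k ≤ E.C.card ∧ 0 < E.k ∧ 0 < E.N.card

/-- `C(P)`: the set of candidates approved by at least one voter. -/
def Election.CP (E : Election) : Finset ℕ := E.N.biUnion E.A

/-- The price `n/k`. -/
noncomputable def Election.price (E : Election) : ℝ := (E.N.card : ℝ) / (E.k : ℝ)

/-- `N(c)`: the set of voters approving candidate `c`. -/
def Election.approvers (E : Election) (c : ℕ) : Finset ℕ :=
  E.N.filter (fun i => c ∈ E.A i)

/-- A committee: a set of at most `k` candidates. -/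
def Election.IsCommittee (E : Election) (W : Finset ℕ) : Prop :=
  W ⊆ E.C ∧ W.card ≤ E.k

/-- The set of candidates approved by every voter in `S` (i.e. `⋂_{i ∈ S} A_i`). -/
def commonApproved (E : Election) (S : Finset ℕ) : Finset ℕ :=
  E.C.filter (fun c => ∀ i ∈ S, c ∈ E.A i)

/-! ### Price systems and priceability -/

/-- A price system: a positive price `p` and payment functions `pay i : C → [0,1]`,
where voter `i` pays only for candidates she approves and spends at most one dollar. -/
structure PriceSystem (E : Election) where
  p : ℝ
  pay : ℕ → ℕ → ℝ
  p_pos : 0 < p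
  pay_nonneg : ∀ i c, 0 ≤ pay i c
  pay_le_one : ∀ i c, pay i c ≤ 1
  pay_approved : ∀ i ∈ E.N, ∀ c : ℕ, 0 < pay i c → c ∈ E.A i
  pay_budget : ∀ i ∈ E.N, ∑ c ∈ E.C, pay i c ≤ 1

/-- The price system supports the committee `W`: every elected candidate receives
total payment `p`, unelected candidates receive nothing, and the supporters of an
unelected candidate have at most `p` unspent budget in total. -/
def PriceSystem.SupportsW {E : Election} (ps : PriceSystem E) (W : Finset ℕ) : Prop :=
  (∀ c ∈ W, ∑ i ∈ E.N, ps.pay i c = ps.p) ∧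
  (∀ c : ℕ, c ∉ W → ∑ i ∈ E.N, ps.pay i c = 0) ∧
  (∀ c ∈ E.C, c ∉ W →
    ∑ i ∈ E.approvers c, (1 - ∑ c' ∈ W, ps.pay i c') ≤ ps.p)

/-- A committee is priceable if some price system supports it. -/
def Priceable (E : Election) (W : Finset ℕ) : Prop :=
  ∃ ps : PriceSystem E, ps.SupportsW W

/-! ### Phragmén's sequential rule, via execution traces -/

/-- An execution trace of Phragmén's sequential rule: `elected j` is the candidate
elected in step `j` (for `j < k`), at time `time j`; `reset j i` is the time at which
voter `i`'s balance was last reset before step `j` (so her balance at time `t` is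
`t - reset j i`).  A candidate is elected at the first moment at which its approvers
jointly hold `n/k` dollars.  -/
structure PhragmenTrace (E : Election) where
  elected : ℕ → ℕ
  time : ℕ → ℝ
  reset : ℕ → ℕ → ℝ
  elected_mem : ∀ j < E.k, elected j ∈ E.C
  elected_inj : ∀ j < E.k, ∀ j' < E.k, elected j = elected j' → j = j'
  time_nonneg : ∀ j, 0 ≤ time j
  time_mono : ∀ j j', j ≤ j' → time j ≤ time j'
  reset_zero : ∀ i, reset 0 i = 0
  reset_succ : ∀ j i, reset (j + 1) i = if elected j ∈ E.A i then time j else reset j i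
  /-- the elected candidate's approvers jointly hold exactly `n/k` at the election time -/
  elect_eq : ∀ j < E.k, ∑ i ∈ E.approvers (elected j), (time j - reset j i) = E.price
  /-- no not-yet-elected candidate's approvers held more than `n/k` at any earlier moment -/
  first : ∀ j < E.k, ∀ c ∈ E.C, (∀ j' < j, elected j' ≠ c) →
    ∑ i ∈ E.approvers c, (time j - reset j i) ≤ E.price

/-- `W` is a possible output of Phragmén's sequential rule (under some tie-breaking). -/
def PhragmenOutput (E : Election) (W : Finset ℕ) : Prop :=
  ∃ tr : PhragmenTrace E, W = (Finset.range E.k).image tr.elected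

/-! ### Rule X -/

/-- Candidate `c` (not yet elected) is `q`-affordable given budgets `b`:
its approvers can raise `n/k` while each paying at most `q`. -/
def Affordable (E : Election) (b : ℕ → ℝ) (W : Finset ℕ) (c : ℕ) (q : ℝ) : Prop :=
  c ∈ E.C ∧ c ∉ W ∧ 0 ≤ q ∧ E.price ≤ ∑ i ∈ E.approvers c, min q (b i)

/-- Reachable states of Rule X: starting from budgets all equal to `1` and the empty
committee, repeatedly add a candidate that is `q`-affordable for the minimum possible `q`
(ties broken arbitrarily), charging each approver `min q (b i)`. -/
inductive RuleXReach (E : Election) : (ℕ → ℝ) → Finset ℕ → Prop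
  | init : RuleXReach E (fun _ => 1) ∅
  | step {b : ℕ → ℝ} {W : Finset ℕ} {c : ℕ} {q : ℝ} :
      RuleXReach E b W →
      Affordable E b W c q →
      (∀ c' q', Affordable E b W c' q' → q ≤ q') →
      RuleXReach E (fun i => if i ∈ E.approvers c then b i - min q (b i) else b i)
        (insert c W)

/-- `W` is a possible output of Rule X (under some tie-breaking): a reachable
committee from which no further candidate is `q`-affordable for any `q`. -/
def RuleXOutput (E : Election) (W : Finset ℕ) : Prop :=
  ∃ b : ℕ → ℝ, RuleXReach E b W ∧ ∀ c q, ¬ Affordable E b W c q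

/-! ### Proportional Approval Voting -/

/-- The harmonic number `H(t) = 1 + 1/2 + ⋯ + 1/t` (with `H(0) = 0`). -/
noncomputable def hsum (t : ℕ) : ℝ := ∑ j ∈ Finset.range t, (1 : ℝ) / (j + 1)

/-- The PAV score of a committee. -/
noncomputable def pavScore (E : Election) (W : Finset ℕ) : ℝ :=
  ∑ i ∈ E.N, hsum ((E.A i ∩ W).card)

/-- `W` is a PAV winning committee: it has maximal PAV score among committees of size at
most `k`. -/
def PavWinner (E : Election) (W : Finset ℕ) : Prop :=
  W ⊆ E.C ∧ W.card ≤ E.k ∧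
  ∀ W' : Finset ℕ, W' ⊆ E.C → W'.card ≤ E.k → pavScore E W' ≤ pavScore E W

/-! ### The core and its approximations -/

/-- `W` is in the core: no nonempty group `S` of voters together with a set `T` of
candidates with `|T|/k ≤ |S|/n` gives every member of `S` strictly more approved
candidates than `W` does. -/
def InCore (E : Election) (W : Finset ℕ) : Prop :=
  ¬ ∃ S T : Finset ℕ, S ⊆ E.N ∧ S.Nonempty ∧ T ⊆ E.C ∧
    T.card * E.N.card ≤ S.card * E.k ∧
    ∀ i ∈ S, (E.A i ∩ W).card < (E.A i ∩ T).card

/-- `W` is in the `λ`-core: no nonempty group `S` and set `T` with `|T|/k ≤ |S|/n`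
and `|A_i ∩ T| > max (λ·|A_i ∩ W|) 1` for every `i ∈ S`. -/
def InLamCore (lam : ℝ) (E : Election) (W : Finset ℕ) : Prop :=
  ¬ ∃ S T : Finset ℕ, S ⊆ E.N ∧ S.Nonempty ∧ T ⊆ E.C ∧
    T.card * E.N.card ≤ S.card * E.k ∧
    ∀ i ∈ S, max (lam * ((E.A i ∩ W).card : ℝ)) 1 < ((E.A i ∩ T).card : ℝ)

/-! ### Pigou–Dalton transfers -/

/-- `W` admits a Pigou–Dalton transfer: there is a committee `W'` of the same size and
voters `i, j` with `|A_j∩W| > |A_i∩W|` such that all other voters' utilities are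
unchanged in `W'`, the combined utility of `i` and `j` is unchanged, and
`|A_j∩W| > |A_j∩W'| ≥ |A_i∩W'| > |A_i∩W|`. -/
def AdmitsPD (E : Election) (W : Finset ℕ) : Prop :=
  ∃ W' : Finset ℕ, W' ⊆ E.C ∧ W'.card = W.card ∧
  ∃ i ∈ E.N, ∃ j ∈ E.N, i ≠ j ∧
    (E.A i ∩ W).card < (E.A j ∩ W).card ∧
    (∀ l ∈ E.N, l ≠ i → l ≠ j → (E.A l ∩ W').card = (E.A l ∩ W).card) ∧
    (E.A i ∩ W').card + (E.A j ∩ W').card = (E.A i ∩ W).card + (E.A j ∩ W).card ∧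
    (E.A j ∩ W').card < (E.A j ∩ W).card ∧
    (E.A i ∩ W').card ≤ (E.A j ∩ W').card ∧
    (E.A i ∩ W).card < (E.A i ∩ W').card

/-! ### Laminar instances and laminar proportionality -/

/-- All ballots are equal. -/
def Unanimous (E : Election) : Prop := ∀ i ∈ E.N, ∀ j ∈ E.N, E.A i = E.A j

/-- `P₋c`: remove candidate `c` from every ballot; the committee size drops by one. -/
def eraseCand (E : Election) (c : ℕ) : Election :=
  { C := E.C.erase c, N := E.N, A := fun i => (E.A i).erase c, k := E.k - 1 }

/-- `E` is the concatenation of two instances `E₁`, `E₂` on disjoint voter sets and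
disjoint candidate sets, with `k = k₁ + k₂` and `n₁/k₁ = n₂/k₂`. -/
def Combines (E E₁ E₂ : Election) : Prop :=
  Disjoint E₁.N E₂.N ∧ Disjoint E₁.CP E₂.CP ∧
  E.N = E₁.N ∪ E₂.N ∧
  (∀ i ∈ E₁.N, E.A i = E₁.A i) ∧ (∀ i ∈ E₂.N, E.A i = E₂.A i) ∧
  E.k = E₁.k + E₂.k ∧ 0 < E₁.k ∧ 0 < E₂.k ∧
  E₁.N.card * E₂.k = E₂.N.card * E₁.k

/-- Laminar election instances. -/
inductive Laminar : Election → Prop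
  | unanimous (E : Election) : Unanimous E → E.k ≤ E.CP.card → Laminar E
  | consensus (E : Election) (c : ℕ) : 0 < E.k → c ∈ E.CP →
      (∀ i ∈ E.N, c ∈ E.A i) →
      ¬ Unanimous (eraseCand E c) → Laminar (eraseCand E c) → Laminar E
  | combine (E E₁ E₂ : Election) : Combines E E₁ E₂ →
      Laminar E₁ → Laminar E₂ → Laminar E

/-- Laminar proportional committees for a laminar instance. -/
inductive LamProp : Election → Finset ℕ → Prop
  | unanimous (E : Election) (W : Finset ℕ) :
      Unanimous E → W ⊆ E.CP → W.card = E.k → LamProp E W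
  | consensus (E : Election) (c : ℕ) (W' : Finset ℕ) : 0 < E.k → c ∈ E.CP →
      (∀ i ∈ E.N, c ∈ E.A i) → Laminar (eraseCand E c) →
      LamProp (eraseCand E c) W' → c ∉ W' → LamProp E (insert c W')
  | combine (E E₁ E₂ : Election) (W₁ W₂ : Finset ℕ) : Combines E E₁ E₂ →
      LamProp E₁ W₁ → LamProp E₂ W₂ → LamProp E (W₁ ∪ W₂)

/-! ### Committee rules and welfarism -/

/-- The welfare vector of `W`: each voter's number of approved committee members
(indexed by voter name, `0` outside `N`). -/
def wvec (E : Election) (W : Finset ℕ) : ℕ → ℕ :=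
  fun i => if i ∈ E.N then (E.A i ∩ W).card else 0

/-- A committee rule returns, on every (valid) instance, a nonempty set of committees
of size at most `k`. -/
def CommitteeRule (f : Election → Set (Finset ℕ)) : Prop :=
  ∀ E : Election, E.Valid → (f E).Nonempty ∧ ∀ W ∈ f E, W ⊆ E.C ∧ W.card ≤ E.k

/-- A rule is welfarist if for each committee size `k` there is a function `g k` of the
welfare vector such that on every instance the rule returns exactly the size-`k`
committees maximizing `g k` of their welfare vector. -/
def Welfarist (f : Election → Set (Finset ℕ)) : Prop :=
  ∃ g : ℕ → (ℕ → ℕ) → ℝ, ∀ E : Election, E.Valid →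
    f E = { W : Finset ℕ | W ⊆ E.C ∧ W.card = E.k ∧
      ∀ W' : Finset ℕ, W' ⊆ E.C → W'.card = E.k →
        g E.k (wvec E W') ≤ g E.k (wvec E W) }

/-- Pareto-optimality of a rule. -/
def ParetoOptimal (f : Election → Set (Finset ℕ)) : Prop :=
  ∀ E : Election, E.Valid → ∀ W ∈ f E,
    ¬ ∃ W' : Finset ℕ, W' ⊆ E.C ∧ W'.card ≤ E.k ∧
      (∀ i ∈ E.N, (E.A i ∩ W).card ≤ (E.A i ∩ W').card) ∧
      (∃ i ∈ E.N, (E.A i ∩ W).card < (E.A i ∩ W').card)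

/-! ### Party-list profiles -/

/-- A party-list profile: any two ballots are equal or disjoint. -/
def PartyList (E : Election) : Prop :=
  ∀ i ∈ E.N, ∀ j ∈ E.N, E.A i = E.A j ∨ Disjoint (E.A i) (E.A j)

/-- The number of voters supporting the party with ballot `B`. -/
def nParty (E : Election) (B : Finset ℕ) : ℕ :=
  (E.N.filter (fun i => E.A i = B)).card

/-! ### Priceability with equal payments -/

/-- `T` is priceable with equal payments in the instance restricted to the voters in `S`
with committee size `|T|`: payments are in `[0,1]`, only for approved candidates,
each voter spends at most `1` on `T`, every `c ∈ T` receives exactly `|S|/|T|` in total,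
and all voters paying for `c` pay the same amount. -/
def PriceableEq (E : Election) (S T : Finset ℕ) : Prop :=
  ∃ pay : ℕ → ℕ → ℝ,
    (∀ i c, 0 ≤ pay i c ∧ pay i c ≤ 1) ∧
    (∀ i ∈ S, ∀ c : ℕ, 0 < pay i c → c ∈ E.A i) ∧
    (∀ i ∈ S, ∑ c ∈ T, pay i c ≤ 1) ∧
    (∀ c ∈ T, ∑ i ∈ S, pay i c = (S.card : ℝ) / (T.card : ℝ)) ∧
    (∀ c ∈ T, ∀ i ∈ S, ∀ j ∈ S, c ∈ E.A i → c ∈ E.A j → pay i c = pay j c)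


theorem Combines.symm {E E₁ E₂ : Election} (h : Combines E E₁ E₂) : Combines E E₂ E₁ := by
  obtain ⟨hN, hC, hE, hA₁, hA₂, hk, hk₁, hk₂, hp⟩ := h
  exact ⟨hN.symm, hC.symm, by rw [hE, Finset.union_comm], hA₂, hA₁, by omega, hk₂, hk₁, hp.symm⟩

/-- The share of the committee `W` paid for by voter `i`, when the cost of each committee member
is divided equally among its approvers. -/
def share (E : Election) (W : Finset ℕ) (i : ℕ) : ℚ :=
  ∑ c ∈ E.A i ∩ W, ((E.approvers c).card : ℚ)⁻¹

theorem Combines.share_left {E E₁ E₂ : Election} (h : Combines E E₁ E₂) {W₁ W₂ : Finset ℕ}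
    (hW₂ : W₂ ⊆ E₂.CP) {i : ℕ} (hi : i ∈ E₁.N) :
    share E (W₁ ∪ W₂) i = share E₁ W₁ i := by
  obtain ⟨hN, hC, hE, hA₁, hA₂, -⟩ := h
  have mem_CP₁ : ∀ j ∈ E₁.N, ∀ c ∈ E₁.A j, c ∈ E₁.CP :=
    fun j hj c hc => Finset.mem_biUnion.2 ⟨j, hj, hc⟩
  have hinter : E.A i ∩ (W₁ ∪ W₂) = E₁.A i ∩ W₁ := by
    ext c
    have h₁ := mem_CP₁ i hi c
    have h₂ := @hW₂ c
    have h₃ : c ∈ E₁.CP → c ∉ E₂.CP := fun h => Finset.disjoint_left.1 hC h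
    rw [hA₁ i hi]
    simp only [Finset.mem_inter, Finset.mem_union]
    tauto
  unfold share
  rw [hinter]
  refine Finset.sum_congr rfl fun c hc => ?_
  have hc₁ : c ∉ E₂.CP :=
    Finset.disjoint_left.1 hC (mem_CP₁ i hi c (Finset.mem_inter.1 hc).1)
  congr 3
  ext j
  simp only [Election.approvers, Finset.mem_filter, hE, Finset.mem_union]
  constructor
  · rintro ⟨hj | hj, hcj⟩
    · exact ⟨hj, hA₁ j hj ▸ hcj⟩
    · exact absurd (Finset.mem_biUnion.2 ⟨j, hj, hA₂ j hj ▸ hcj⟩) hc₁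
  · rintro ⟨hj, hcj⟩
    exact ⟨Or.inl hj, (hA₁ j hj).symm ▸ hcj⟩

theorem Combines.card_mul_share {E E₁ E₂ : Election} (h : Combines E E₁ E₂) {W₁ W₂ : Finset ℕ}
    (hW₂ : W₂ ⊆ E₂.CP) {i : ℕ} (hi : i ∈ E₁.N) (hs : E₁.N.card * share E₁ W₁ i = E₁.k) :
    E.N.card * share E (W₁ ∪ W₂) i = E.k := by
  rw [h.share_left hW₂ hi]
  obtain ⟨hN, -, hE, -, -, hk, -, -, hp⟩ := h
  have hpos : (E₁.N.card : ℚ) ≠ 0 := by exact_mod_cast (Finset.card_pos.2 ⟨i, hi⟩).ne'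
  have hp' : (E₁.N.card : ℚ) * E₂.k = E₂.N.card * E₁.k := by exact_mod_cast hp
  rw [hE, Finset.card_union_of_disjoint hN, hk]
  push_cast
  apply mul_left_cancel₀ hpos
  linear_combination ((E₁.N.card : ℚ) + E₂.N.card) * hs - hp'

/-- In a laminar proportional committee all voters pay the same share of the committee. -/
theorem LamProp.card_mul_share {E : Election} {W : Finset ℕ} (h : LamProp E W) :
    W ⊆ E.CP ∧ ∀ i ∈ E.N, E.N.card * share E W i = E.k := by
  induction h with
  | unanimous E W hU hW hk =>
    refine ⟨hW, fun i hi => ?_⟩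
    have hCP : E.CP ⊆ E.A i := by
      intro c hc
      obtain ⟨j, hj, hcj⟩ := Finset.mem_biUnion.1 hc
      exact hU i hi j hj ▸ hcj
    have happ : ∀ c ∈ W, E.approvers c = E.N := fun c hc =>
      Finset.filter_true_of_mem fun j hj => hU i hi j hj ▸ hCP (hW hc)
    have hpos : (E.N.card : ℚ) ≠ 0 := by exact_mod_cast (Finset.card_pos.2 ⟨i, hi⟩).ne'
    rw [share, Finset.inter_eq_right.2 (hW.trans hCP),
      Finset.sum_congr rfl fun c hc => by rw [happ c hc], Finset.sum_const, hk, nsmul_eq_mul]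
    field_simp
  | consensus E c W' hk hc hall _ _ hcW ih =>
    obtain ⟨hW', hs⟩ := ih
    refine ⟨?_, fun i hi => ?_⟩
    · refine Finset.insert_subset hc fun d hd => ?_
      obtain ⟨j, hj, hdj⟩ := Finset.mem_biUnion.1 (hW' hd)
      exact Finset.mem_biUnion.2 ⟨j, hj, Finset.mem_of_mem_erase hdj⟩
    · have hpos : (E.N.card : ℚ) ≠ 0 := by exact_mod_cast (Finset.card_pos.2 ⟨i, hi⟩).ne'
      have hsum : share E (insert c W') i = (E.N.card : ℚ)⁻¹ + share (eraseCand E c) W' i := by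
        have happ : E.approvers c = E.N := Finset.filter_true_of_mem hall
        have hinter : (eraseCand E c).A i ∩ W' = E.A i ∩ W' := by
          ext d
          simp only [eraseCand, Finset.mem_inter, Finset.mem_erase]
          grind
        rw [share, Finset.inter_insert_of_mem (hall i hi),
          Finset.sum_insert (fun h => hcW (Finset.mem_inter.1 h).2), happ, share, hinter]
        congr 1
        refine Finset.sum_congr rfl fun d hd => ?_
        have hdc : d ≠ c := fun h => hcW (h ▸ (Finset.mem_inter.1 hd).2)
        simp [Election.approvers, eraseCand, hdc]
      have hi' := hs i hi
      have hk' : ((eraseCand E c).k : ℚ) = E.k - 1 := by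
        simp [eraseCand, Nat.cast_sub (Nat.succ_le_of_lt hk)]
      rw [hk'] at hi'
      rw [hsum, mul_add, mul_inv_cancel₀ hpos, show (E.N.card : ℚ) * _ = _ from hi']
      ring
  | combine E E₁ E₂ W₁ W₂ h _ _ ih₁ ih₂ =>
    obtain ⟨hW₁, hs₁⟩ := ih₁
    obtain ⟨hW₂, hs₂⟩ := ih₂
    have hCP : ∀ {F G : Election}, Combines E F G → F.CP ⊆ E.CP := by
      rintro F G ⟨-, -, hE, hA, -⟩ c hc
      obtain ⟨j, hj, hcj⟩ := Finset.mem_biUnion.1 hc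
      exact Finset.mem_biUnion.2 ⟨j, hE ▸ Finset.mem_union_left _ hj, (hA j hj).symm ▸ hcj⟩
    refine ⟨Finset.union_subset (hW₁.trans (hCP h)) (hW₂.trans (hCP h.symm)), fun i hi => ?_⟩
    have hmem : i ∈ E₁.N ∪ E₂.N := h.2.2.1 ▸ hi
    obtain hi | hi := Finset.mem_union.1 hmem
    · exact h.card_mul_share hW₂ hi (hs₁ i hi)
    · rw [Finset.union_comm]
      exact h.symm.card_mul_share hW₁ hi (hs₂ i hi)

/-- The election with eight seats and voters `a`, `b`, `c`, `d`, in which `a` and `b` share two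
candidates and approve one further candidate each, while `c` and `d` approve three candidates
of their own each. -/
def pairElection (a b c d : ℕ) : Election where
  C := Finset.range 10
  N := {a, b, c, d}
  A i := if i = a then {0, 1, 2} else if i = b then {0, 1, 3} else
    if i = c then {4, 5, 6} else {7, 8, 9}
  k := 8

theorem pairElection_valid (a b c d : ℕ) : (pairElection a b c d).Valid := by
  refine ⟨fun i _ => ?_, ?_, ?_, ?_⟩
  · simp only [pairElection]
    split_ifs <;> decide
  · simp [pairElection]
  · simp [pairElection]
  · simp [pairElection]

/-- The part of an election formed by the voters in `N` and `k` seats. -/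
def Election.part (E : Election) (N : Finset ℕ) (k : ℕ) : Election :=
  { E with N := N, k := k }

theorem Laminar.part_singleton {E : Election} {i k : ℕ} (h : k ≤ (E.A i).card) :
    Laminar (E.part {i} k) := by
  refine .unanimous _ ?_ (by simpa [Election.part, Election.CP] using h)
  simp [Unanimous, Election.part]

theorem Laminar.part_pair {E : Election} {i j k : ℕ} (hij : i ≠ j) (hk : 0 < k)
    (hi : k ≤ (E.A i).card) (hj : k ≤ (E.A j).card) (hd : Disjoint (E.A i) (E.A j)) :
    Laminar (E.part {i, j} (k + k)) := by
  refine .combine _ (E.part {i} k) (E.part {j} k) ?_ (.part_singleton hi) (.part_singleton hj)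
  refine ⟨?_, ?_, Finset.insert_eq _ _, fun _ _ => rfl, fun _ _ => rfl, rfl, hk, hk, rfl⟩
  · simpa [Election.part] using hij
  · simpa [Election.part, Election.CP] using hd

theorem pairElection_laminar {a b c d : ℕ} (h : [a, b, c, d].Nodup) :
    Laminar (pairElection a b c d) := by
  obtain ⟨hab, hac, had, hbc, hbd, hcd⟩ :
      a ≠ b ∧ a ≠ c ∧ a ≠ d ∧ b ≠ c ∧ b ≠ d ∧ c ≠ d := by
    simpa [and_assoc] using h
  set E := pairElection a b c d with hE
  have hAa : E.A a = {0, 1, 2} := by simp [hE, pairElection]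
  have hAb : E.A b = {0, 1, 3} := by simp [hE, pairElection, hab.symm]
  have hAc : E.A c = {4, 5, 6} := by simp [hE, pairElection, hac.symm, hbc.symm]
  have hAd : E.A d = {7, 8, 9} := by simp [hE, pairElection, had.symm, hbd.symm, hcd.symm]
  have hcd' : Laminar (E.part {c, d} (2 + 2)) := by
    refine .part_pair hcd (by decide) ?_ ?_ ?_ <;> simp only [hAc, hAd] <;> decide
  have hrest : Laminar (eraseCand (eraseCand (E.part {a, b} 4) 0) 1) := by
    refine Laminar.part_pair (E := eraseCand (eraseCand E 0) 1) (k := 1) hab (by decide) ?_ ?_ ?_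
      <;> simp only [eraseCand, hAa, hAb] <;> decide
  have hab' : Laminar (E.part {a, b} 4) := by
    refine .consensus _ 0 (Nat.succ_pos _) ?_ ?_ ?_ (.consensus _ 1 (Nat.succ_pos _) ?_ ?_ ?_ hrest)
    · simp [Election.part, Election.CP, hAa]
    · simp [Election.part, hAa, hAb]
    · simp only [Unanimous, eraseCand, Election.part]
      intro h
      have := h a (by simp) b (by simp)
      rw [hAa, hAb] at this
      revert this; decide
    · simp [eraseCand, Election.part, Election.CP, hAa]
    · simp [eraseCand, Election.part, hAa, hAb]
    · simp only [Unanimous, eraseCand, Election.part]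
      intro h
      have := h a (by simp) b (by simp)
      rw [hAa, hAb] at this
      revert this; decide
  refine .combine _ _ _ ?_ hab' hcd'
  refine ⟨?_, ?_, ?_, fun _ _ => rfl, fun _ _ => rfl, rfl, Nat.succ_pos _, Nat.succ_pos _, ?_⟩
  · simp [Election.part, hac.symm, had.symm, hbc.symm, hbd.symm]
  · simp only [Election.CP, Election.part, Finset.biUnion_insert, Finset.singleton_biUnion,
      hAa, hAb, hAc, hAd]
    decide
  · ext i
    simp only [hE, pairElection, Election.part, Finset.mem_insert, Finset.mem_union,
      Finset.mem_singleton, or_assoc]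
  · simp [Election.part, Finset.card_pair hab, Finset.card_pair hcd]

/-- The welfare vector giving `x` to voters `a`, `b` and `y` to voters `c`, `d`. -/
def pairVec (a b c d x y : ℕ) : ℕ → ℕ := fun i =>
  if i = a ∨ i = b then x else if i = c ∨ i = d then y else 0

theorem wvec_pairElection_eq {a b c d x y : ℕ} (h : [a, b, c, d].Nodup) {W : Finset ℕ}
    (ha : (({0, 1, 2} : Finset ℕ) ∩ W).card = x) (hb : (({0, 1, 3} : Finset ℕ) ∩ W).card = x)
    (hc : (({4, 5, 6} : Finset ℕ) ∩ W).card = y) (hd : (({7, 8, 9} : Finset ℕ) ∩ W).card = y) :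
    wvec (pairElection a b c d) W = pairVec a b c d x y := by
  funext i
  simp only [wvec, pairElection, pairVec, Finset.mem_insert, Finset.mem_singleton]
  grind

theorem sum_triple_inter {M : Type*} [AddCommMonoid M] (φ : ℕ → M) {x y z : ℕ} (W : Finset ℕ)
    (hxy : x ≠ y) (hxz : x ≠ z) (hyz : y ≠ z) :
    ∑ c ∈ {x, y, z} ∩ W, φ c = (if x ∈ W then φ x else 0) +
      ((if y ∈ W then φ y else 0) + if z ∈ W then φ z else 0) := by
  rw [← Finset.filter_mem_eq_inter, Finset.sum_filter, Finset.sum_insert (by simp [hxy, hxz]),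
    Finset.sum_insert (by simpa using hyz), Finset.sum_singleton]

theorem wvec_of_lamProp {a b c d : ℕ} (h : [a, b, c, d].Nodup) {W : Finset ℕ}
    (hW : LamProp (pairElection a b c d) W) :
    wvec (pairElection a b c d) W = pairVec a b c d 3 2 := by
  have hs := hW.card_mul_share.2
  have hcard : (pairElection a b c d).N.card = 4 := by
    have := List.toFinset_card_of_nodup h
    simpa [pairElection] using this
  obtain ⟨hab, hac, had, hbc, hbd, hcd⟩ :
      a ≠ b ∧ a ≠ c ∧ a ≠ d ∧ b ≠ c ∧ b ≠ d ∧ c ≠ d := by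
    simpa [and_assoc] using h
  have happ : ∀ x, (pairElection a b c d).approvers x =
      if x = 0 ∨ x = 1 then {a, b} else if x = 2 then {a} else if x = 3 then {b} else
      if x = 4 ∨ x = 5 ∨ x = 6 then {c} else if x = 7 ∨ x = 8 ∨ x = 9 then {d} else ∅ := by
    intro x
    ext i
    simp only [Election.approvers, pairElection]
    grind
  have hsa := hs a (by simp [pairElection])
  have hsb := hs b (by simp [pairElection])
  have hsc := hs c (by simp [pairElection])
  have hsd := hs d (by simp [pairElection])
  simp only [hcard, share, happ] at hsa hsb hsc hsd
  simp [pairElection, hac.symm, had.symm, hbc.symm, hbd.symm, hcd.symm, hab, hab.symm,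
    sum_triple_inter] at hsa hsb hsc hsd
  apply wvec_pairElection_eq h <;> rw [Finset.card_eq_sum_ones, sum_triple_inter] <;> try decide
  · revert hsa hsb
    split_ifs <;> norm_num
  · revert hsa hsb
    split_ifs <;> norm_num
  · revert hsc
    split_ifs <;> norm_num
  · revert hsd
    split_ifs <;> norm_num

theorem lt_of_welfarist {f : Election → Set (Finset ℕ)} {g : ℕ → (ℕ → ℕ) → ℝ}
    (hf : CommitteeRule f)
    (hg : ∀ E : Election, E.Valid →
      f E = { W : Finset ℕ | W ⊆ E.C ∧ W.card = E.k ∧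
        ∀ W' : Finset ℕ, W' ⊆ E.C → W'.card = E.k → g E.k (wvec E W') ≤ g E.k (wvec E W) })
    (hlam : ∀ E : Election, E.Valid → Laminar E → ∀ W ∈ f E, LamProp E W)
    {a b c d : ℕ} (h : [a, b, c, d].Nodup) :
    g 8 (pairVec a b c d 2 3) < g 8 (pairVec a b c d 3 2) := by
  have hv := pairElection_valid a b c d
  have hprop := hlam _ hv (pairElection_laminar h)
  obtain ⟨W, hW⟩ := (hf _ hv).1
  have hWvec := wvec_of_lamProp h (hprop W hW)
  let W' : Finset ℕ := {0, 1, 4, 5, 6, 7, 8, 9}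
  have hW'vec : wvec (pairElection a b c d) W' = pairVec a b c d 2 3 := by
    apply wvec_pairElection_eq h <;> decide
  by_contra hle
  rw [not_lt] at hle
  rw [hg _ hv] at hW hprop
  have hWC : W' ⊆ Finset.range 10 := by decide
  have hW' := wvec_of_lamProp h (hprop W' ⟨hWC, rfl, fun V hV hVk =>
    (hW.2.2 V hV hVk).trans (by rw [hWvec, hW'vec]; exact hle)⟩)
  have := congrFun (hW'vec.symm.trans hW') a
  simp [pairVec] at this

/-- No welfarist committee rule satisfies laminar proportionality,
i.e., no welfarist rule returns only laminar proportional committees on every laminar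
instance. -/
theorem no_welfarist_laminar_proportional :
    ¬ ∃ f : Election → Set (Finset ℕ), CommitteeRule f ∧ Welfarist f ∧
      (∀ E : Election, E.Valid → Laminar E → ∀ W ∈ f E, LamProp E W) := by
  rintro ⟨f, hf, ⟨g, hg⟩, hlam⟩
  have h₁ := lt_of_welfarist hf hg hlam (a := 0) (b := 1) (c := 2) (d := 3) (by decide)
  have h₂ := lt_of_welfarist hf hg hlam (a := 2) (b := 3) (c := 0) (d := 1) (by decide)
  have hswap : ∀ x y, pairVec 2 3 0 1 x y = pairVec 0 1 2 3 y x := by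
    intro x y
    funext i
    simp only [pairVec]
    grind
  rw [hswap, hswap] at h₂
  exact lt_asymm h₁ h₂

end ABC
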